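/- Let G be a loopless weighted graph (q_e ≠ 0 for every edge e) and let t ∈ K^n. Set X·t = t_1 X_1 + … + t_n X_n ∈ Φ_{G,Q}, let 𝒟 = { Σ_i D_o(i)·t_i : o an orientation of G } ⊆ K be the (finite) set of values of score vectors paired with t, and let z = Σ_i t_i · ( Σ_{e : b e = i} q_e ). Then the minimal polynomial of X·t over K equals ∏_{s ∈ 𝒟} ( x − (s − z) ), the product being over the distinct elements of 𝒟. -/

import Mathlib

open MvPolynomial

set_option synthInstance.maxHeartbeats 1000000
set_option maxHeartbeats 1000000

noncomputable section

/-- The ideal of relations `u_e ^ 2 = q_e * u_e`. -/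
def relIdeal (K : Type*) [Field K] (E : Type*) (q : E → K) :
    Ideal (MvPolynomial E K) :=
  Ideal.span (Set.range fun e : E => (X e) ^ 2 - C (q e) * X e)

/-- The algebra `Φ_{G,Q}`. -/
abbrev PhiAlg (K : Type*) [Field K] (E : Type*) (q : E → K) : Type _ :=
  MvPolynomial E K ⧸ relIdeal K E q

/-- The generator `X_i` of the `Q`-deformation. -/
def XX (K : Type*) [Field K] {n : ℕ} {E : Type*} [Fintype E]
    (a b : E → Fin n) (q : E → K) (i : Fin n) : PhiAlg K E q :=
  Ideal.Quotient.mk _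
    ((∑ e ∈ Finset.univ.filter fun e => a e = i, X e) -
      ∑ e ∈ Finset.univ.filter fun e => b e = i, X e)

/-- The `Q`-deformation `Ψ_{G,Q}` of the Postnikov–Shapiro algebra. -/
def PsiAlg (K : Type*) [Field K] {n : ℕ} {E : Type*} [Fintype E]
    (a b : E → Fin n) (q : E → K) : Subalgebra K (PhiAlg K E q) :=
  Algebra.adjoin K (Set.range (XX K a b q))

/-- The head of edge `e` under orientation `o`. -/
def head {n : ℕ} {E : Type*} (a b : E → Fin n) (o : E → Bool) (e : E) : Fin n :=
  if o e then a e else b e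

/-- The tail of edge `e` under orientation `o`. -/
def tail {n : ℕ} {E : Type*} (a b : E → Fin n) (o : E → Bool) (e : E) : Fin n :=
  if o e then b e else a e

/-- The score vector of an orientation. -/
def score (K : Type*) [Field K] {n : ℕ} {E : Type*} [Fintype E]
    (a b : E → Fin n) (q : E → K) (o : E → Bool) (i : Fin n) : K :=
  ∑ e ∈ Finset.univ.filter fun e => head a b o e = i, q e

/-- The value of `u_e` at the orientation `o`. -/
def pt {K E : Type*} [Field K] (q : E → K) (o : E → Bool) (e : E) : K :=
  if o e then q e else 0

/-- Evaluation at an orientation. -/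
def evo {K E : Type*} [Field K] (q : E → K) (o : E → Bool) : PhiAlg K E q →ₐ[K] K :=
  Ideal.Quotient.liftₐ (relIdeal K E q) (MvPolynomial.aeval (pt q o)) (by
    intro f hf
    have h : relIdeal K E q ≤ RingHom.ker (MvPolynomial.aeval (R := K) (pt q o)) := by
      refine Ideal.span_le.2 ?_
      rintro _ ⟨e, rfl⟩
      simp only [SetLike.mem_coe, RingHom.mem_ker, map_sub, map_pow, map_mul, aeval_X, aeval_C]
      by_cases h : o e <;> simp [pt, h, pow_two]
    exact h hf)

/-- The class of `u_e`. -/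
def uu {K E : Type*} [Field K] (q : E → K) (e : E) : PhiAlg K E q :=
  Ideal.Quotient.mk _ (X e)

lemma evo_uu {K E : Type*} [Field K] (q : E → K) (o : E → Bool) (e : E) :
    evo q o (uu q e) = pt q o e := by
  have : evo q o (uu q e) = MvPolynomial.aeval (pt q o) (X e : MvPolynomial E K) := rfl
  rw [this, aeval_X]

lemma uu_mul {K E : Type*} [Field K] (q : E → K) (e : E) :
    uu q e * uu q e = q e • uu q e := by
  have h : (Ideal.Quotient.mk (relIdeal K E q)) (X e ^ 2) =
      Ideal.Quotient.mk (relIdeal K E q) (C (q e) * X e) :=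
    Ideal.Quotient.eq.2 (Ideal.subset_span ⟨e, rfl⟩)
  rw [← MvPolynomial.smul_eq_C_mul, pow_two, map_mul] at h
  exact h

lemma xt_eq {K : Type*} [Field K] {n : ℕ} {E : Type*} [Fintype E]
    (a b : E → Fin n) (q : E → K) (t : Fin n → K) :
    (∑ i, t i • XX K a b q i) = ∑ e, (t (a e) - t (b e)) • uu q e := by
  have h : ∀ i, t i • XX K a b q i =
      ∑ e, ((if a e = i then t i • uu q e else 0) - (if b e = i then t i • uu q e else 0)) := by
    intro i
    simp only [XX, map_sub, map_sum, Finset.sum_filter, smul_sub, Finset.smul_sum,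
      Finset.sum_sub_distrib]
    congr 1 <;> refine Finset.sum_congr rfl fun e _ => ?_ <;> split_ifs <;> simp [uu]
  simp only [h]
  rw [Finset.sum_comm]
  refine Finset.sum_congr rfl fun e _ => ?_
  simp [Finset.sum_sub_distrib, sub_smul]

lemma score_eq {K : Type*} [Field K] {n : ℕ} {E : Type*} [Fintype E]
    (a b : E → Fin n) (q : E → K) (t : Fin n → K) (o : E → Bool) :
    (∑ i, score K a b q o i * t i) -
      (∑ i, t i * ∑ e ∈ Finset.univ.filter fun e => b e = i, q e) =
      ∑ e, (t (a e) - t (b e)) * pt q o e := by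
  have h1 : (∑ i, score K a b q o i * t i) = ∑ e, q e * t (head a b o e) := by
    simp only [score, Finset.sum_mul, Finset.sum_filter]
    rw [Finset.sum_comm' (t' := Finset.univ) (s' := fun _ => Finset.univ) (by simp)]
    simp [ite_mul]
  have h2 : (∑ i, t i * ∑ e ∈ Finset.univ.filter fun e => b e = i, q e) =
      ∑ e, t (b e) * q e := by
    simp only [Finset.mul_sum, Finset.sum_filter]
    rw [Finset.sum_comm]
    simp [mul_ite]
  rw [h1, h2, ← Finset.sum_sub_distrib]
  refine Finset.sum_congr rfl fun e _ => ?_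
  by_cases h : o e <;> simp [pt, head, h] <;> ring

/-- Local idempotent factors. -/
def fac {K E : Type*} [Field K] (q : E → K) (e : E) (c : Bool) : PhiAlg K E q :=
  if c then (q e)⁻¹ • uu q e else 1 - (q e)⁻¹ • uu q e

lemma uu_mul_fac {K E : Type*} [Field K] (q : E → K) (hq : ∀ e, q e ≠ 0) (e : E)
    (o : E → Bool) : uu q e * fac q e (o e) = pt q o e • fac q e (o e) := by
  by_cases h : o e
  · simp only [fac, pt, h, if_true, mul_smul_comm, uu_mul]
    rw [smul_comm]
  · simp [fac, pt, h, mul_sub]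
    rw [mul_smul_comm, uu_mul, smul_smul, inv_mul_cancel₀ (hq e), one_smul, sub_self]

lemma sum_idem {K E : Type*} [Field K] [Fintype E] [DecidableEq E] (q : E → K) :
    ∑ o : E → Bool, ∏ e, fac q e (o e) = 1 := by
  have := Finset.prod_univ_sum (fun _ : E => (Finset.univ : Finset Bool)) (fun e c => fac q e c)
  rw [Fintype.piFinset_univ] at this
  rw [← this]
  exact Finset.prod_eq_one fun e _ => by simp [fac]

lemma aeval_mul_of_eigen {K A : Type*} [Field K] [CommRing A] [Algebra K A] (x y : A) (c : K)
    (h : x * y = c • y) (p : Polynomial K) : Polynomial.aeval x p * y = p.eval c • y := by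
  induction p using Polynomial.induction_on' with
  | add p r hp hr => simp [add_mul, add_smul, hp, hr]
  | monomial k d =>
    have hk : x ^ k * y = c ^ k • y := by
      induction k with
      | zero => simp
      | succ k ih => rw [pow_succ, mul_assoc, h, mul_smul_comm, ih, smul_smul, pow_succ, mul_comm]
    rw [Polynomial.aeval_monomial, Polynomial.eval_monomial, mul_assoc, hk, mul_smul,
      Algebra.smul_def d]

/-- The minimal polynomial of `X·t = ∑ t_i X_i` in `Φ_{G,Q}` is
`∏_{s ∈ 𝒟} (x - (s - z))`, the product over the distinct values `s` of score vectors paired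
with `t`, where `z = ∑_i t_i ∑_{e : b e = i} q_e`. -/
theorem minpoly_linear_combination
    {K : Type*} [Field K] [CharZero K] {n : ℕ} {E : Type*} [Fintype E] [DecidableEq E]
    (a b : E → Fin n) (q : E → K) (hab : ∀ e, a e < b e) (hq : ∀ e, q e ≠ 0)
    (t : Fin n → K) :
    minpoly K (∑ i, t i • XX K a b q i) =
      ∏ s ∈ @Finset.image (E → Bool) K (Classical.decEq K)
          (fun o => ∑ i, score K a b q o i * t i) Finset.univ,
        (Polynomial.X - Polynomial.C
          (s - ∑ i, t i * ∑ e ∈ Finset.univ.filter fun e => b e = i, q e)) := by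
  classical
  set z := ∑ i, t i * ∑ e ∈ Finset.univ.filter fun e => b e = i, q e with hz
  set D := @Finset.image (E → Bool) K (Classical.decEq K)
          (fun o => ∑ i, score K a b q o i * t i) Finset.univ with hD
  set P : Polynomial K := ∏ s ∈ D, (Polynomial.X - Polynomial.C (s - z)) with hP
  set x := ∑ i, t i • XX K a b q i with hx
  have hx' : x = ∑ e, (t (a e) - t (b e)) • uu q e := xt_eq a b q t
  have hPm : P.Monic := Polynomial.monic_prod_of_monic _ _ fun s _ => Polynomial.monic_X_sub_C _
  have hP0 : Polynomial.aeval x P = 0 := by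
    rw [← mul_one (Polynomial.aeval x P), ← sum_idem q, Finset.mul_sum]
    refine Finset.sum_eq_zero fun o _ => ?_
    rw [aeval_mul_of_eigen x _ ((∑ i, score K a b q o i * t i) - z)]
    · have : P.eval ((∑ i, score K a b q o i * t i) - z) = 0 := by
        rw [hP, Polynomial.eval_prod]
        refine Finset.prod_eq_zero (i := ∑ i, score K a b q o i * t i) ?_
          (by rw [Polynomial.eval_sub, Polynomial.eval_X, Polynomial.eval_C, sub_self])
        exact Finset.mem_image.2 ⟨o, Finset.mem_univ _, rfl⟩
      rw [this, zero_smul]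
    · rw [hz, score_eq, hx', Finset.sum_mul, Finset.sum_smul]
      refine Finset.sum_congr rfl fun e _ => ?_
      rw [← Finset.mul_prod_erase _ _ (Finset.mem_univ e), smul_mul_assoc, ← mul_assoc,
        uu_mul_fac q hq, mul_smul, smul_mul_assoc]
  have hint : IsIntegral K x := ⟨P, hPm, hP0⟩
  refine Polynomial.eq_of_monic_of_associated (minpoly.monic hint) hPm
    (associated_of_dvd_dvd (minpoly.dvd K x hP0) ?_)
  refine Finset.prod_dvd_of_coprime ?_ ?_
  · intro s _ s' _ hs
    exact Polynomial.isCoprime_X_sub_C_of_isUnit_sub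
      (by simpa [sub_eq_zero] using hs)
  · intro s hs
    obtain ⟨o, -, rfl⟩ := Finset.mem_image.1 hs
    rw [Polynomial.dvd_iff_isRoot]
    have h1 : evo q o x = (∑ i, score K a b q o i * t i) - z := by
      rw [hz, score_eq, hx', map_sum]
      refine Finset.sum_congr rfl fun e _ => ?_
      rw [map_smul, evo_uu, smul_eq_mul]
    have h2 := congrArg (evo q o) (minpoly.aeval K x)
    rw [← Polynomial.aeval_algHom_apply, h1, map_zero] at h2
    simpa using h2

end
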